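/- Let P₁, Q₁ be mutually absolutely continuous probability measures on a measurable space Ω₁ with r = dQ₁/dP₁. Let (P₂ᵃ, Q₂ᵃ) and (P₂ᵇ, Q₂ᵇ) be pairs of mutually absolutely continuous probability measures on a measurable space Ω₂, with hockey-stick curves h_a(γ) = D_γ(P₂ᵃ ‖ Q₂ᵃ) and h_b(γ) = D_γ(P₂ᵇ ‖ Q₂ᵇ). Fix γ₀ ≥ 0, let A = {y₁ ∈ Ω₁ : h_a(γ₀·r(y₁)) ≥ h_b(γ₀·r(y₁))}, and define Markov kernels κ_P(y₁) = P₂ᵃ if y₁ ∈ A and κ_P(y₁) = P₂ᵇ otherwise, and κ_Q(y₁) = Q₂ᵃ if y₁ ∈ A and κ_Q(y₁) = Q₂ᵇ otherwise. If P₁({y₁ : h_a(γ₀·r(y₁)) > h_b(γ₀·r(y₁))}) > 0 and P₁({y₁ : h_a(γ₀·r(y₁)) < h_b(γ₀·r(y₁))}) > 0, then D_{γ₀}(P₁ ⊗ κ_P ‖ Q₁ ⊗ κ_Q) > max( D_{γ₀}(P₁ × P₂ᵃ ‖ Q₁ × Q₂ᵃ), D_{γ₀}(P₁ × P₂ᵇ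 ‖ Q₁ × Q₂ᵇ) ). This is the key inequality showing that, in the presence of a calibration point, adaptive selection of the second mechanism exceeds every tensor-product bound, so the natural f-DP filter is invalid. -/

import Mathlib

open MeasureTheory ProbabilityTheory

/-- The hockey-stick divergence of order `γ ≥ 0` of `P` from `Q`, computed with the
dominating measure `P + Q`:  `D_γ(P‖Q) = ∫ max(p − γ·q, 0) d(P+Q)` where `p, q` are the
densities of `P, Q` w.r.t. `P + Q`. (The value does not depend on the choice of
dominating measure.) -/
noncomputable def hockeyStick {Ω : Type*} [MeasurableSpace Ω] (γ : ℝ)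
    (P Q : Measure Ω) : ℝ :=
  ∫ y, max ((P.rnDeriv (P + Q) y).toReal - γ * (Q.rnDeriv (P + Q) y).toReal) 0 ∂(P + Q)


lemma int_lt {Ω : Type*} [MeasurableSpace Ω] {μ : Measure Ω} {f g : Ω → ℝ}
    (hf : Integrable f μ) (hg : Integrable g μ) (hle : ∀ x, f x ≤ g x)
    (h : μ {x | f x < g x} ≠ 0) : ∫ x, f x ∂μ < ∫ x, g x ∂μ := by
  rw [← sub_pos, ← integral_sub hg hf,
    integral_pos_iff_support_of_nonneg (fun x => sub_nonneg.2 (hle x)) (hg.sub hf)]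
  refine (pos_iff_ne_zero.2 h).trans_le (measure_mono fun x hx => ?_)
  exact (sub_pos.2 hx).ne'

lemma hs_eq {Ω : Type*} [MeasurableSpace Ω] (γ : ℝ) (P Q : Measure Ω)
    [IsFiniteMeasure P] [IsFiniteMeasure Q] (g : Ω → ENNReal) (hg : Measurable g)
    (h : Q = P.withDensity g) :
    hockeyStick γ P Q = ∫ y, max (1 - γ * (g y).toReal) 0 ∂P := by
  have hQP : Q ≪ P := by rw [h]; exact withDensity_absolutelyContinuous _ _
  have hP : P ≪ P + Q := Measure.AbsolutelyContinuous.rfl.add_right Q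
  have h1 := Measure.rnDeriv_mul_rnDeriv (κ := P + Q) hQP
  have hgd : Q.rnDeriv P =ᵐ[P] g := by
    rw [h]; exact Measure.rnDeriv_withDensity P hg
  have e1 : hockeyStick γ P Q = ∫ y, max (1 - γ * (Q.rnDeriv P y).toReal) 0 ∂P := by
    unfold hockeyStick
    rw [← integral_rnDeriv_smul hP]
    apply integral_congr_ae
    filter_upwards [h1] with y hy
    rw [← hy]
    simp only [Pi.mul_apply, ENNReal.toReal_mul, smul_eq_mul]
    rw [mul_max_of_nonneg _ _ ENNReal.toReal_nonneg]
    congr 1 <;> ring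
  rw [e1]
  apply integral_congr_ae
  filter_upwards [hgd] with y hy
  rw [hy]

lemma hs_comp {Ω₁ Ω₂ : Type*} [MeasurableSpace Ω₁] [MeasurableSpace Ω₂]
    (P₁ Q₁ : Measure Ω₁) [IsProbabilityMeasure P₁] [IsProbabilityMeasure Q₁]
    (hQP : Q₁ ≪ P₁) (κP κQ : Kernel Ω₁ Ω₂) [IsMarkovKernel κP] [IsMarkovKernel κQ]
    (s : Ω₁ → Ω₂ → ENNReal) (hs : Measurable (Function.uncurry s))
    (hκ : ∀ x, κQ x = (κP x).withDensity (s x)) (γ : ℝ) (hγ : 0 ≤ γ) :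
    Integrable (fun x => hockeyStick (γ * (Q₁.rnDeriv P₁ x).toReal) (κP x) (κQ x)) P₁ ∧
    hockeyStick γ (P₁ ⊗ₘ κP) (Q₁ ⊗ₘ κQ) =
      ∫ x, hockeyStick (γ * (Q₁.rnDeriv P₁ x).toReal) (κP x) (κQ x) ∂P₁ := by
  set r := Q₁.rnDeriv P₁ with hr
  have hrm : Measurable r := Measure.measurable_rnDeriv _ _
  have hQ : Q₁ = P₁.withDensity r := (Measure.withDensity_rnDeriv_eq _ _ hQP).symm
  have hgm : Measurable (fun z : Ω₁ × Ω₂ => r z.1 * s z.1 z.2) :=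
    (hrm.comp measurable_fst).mul hs
  have hsx : ∀ x, Measurable (s x) := fun x => hs.comp measurable_prodMk_left
  have hd : Q₁ ⊗ₘ κQ = (P₁ ⊗ₘ κP).withDensity (fun z => r z.1 * s z.1 z.2) := by
    ext t ht
    rw [withDensity_apply _ ht, ← lintegral_indicator ht,
      Measure.lintegral_compProd (hgm.indicator ht), Measure.compProd_apply ht, hQ,
      lintegral_withDensity_eq_lintegral_mul _ hrm (Kernel.measurable_kernel_prodMk_left ht)]
    apply lintegral_congr
    intro x
    have hx : MeasurableSet (Prod.mk x ⁻¹' t) := measurable_prodMk_left ht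
    simp only [Pi.mul_apply]
    rw [hκ, withDensity_apply _ hx, ← lintegral_indicator hx,
      ← lintegral_const_mul _ ((hsx x).indicator hx)]
    apply lintegral_congr
    intro y
    by_cases hy : (x, y) ∈ t
    · simp [Set.indicator, hy]
    · simp [Set.indicator, hy]
  have hpt : ∀ x, hockeyStick (γ * (r x).toReal) (κP x) (κQ x) =
      ∫ y, max (1 - γ * (r x * s x y).toReal) 0 ∂(κP x) := by
    intro x
    rw [hs_eq _ _ _ (s x) (hsx x) (hκ x)]
    simp only [ENNReal.toReal_mul, mul_assoc]
  have hint : Integrable (fun z : Ω₁ × Ω₂ => max (1 - γ * (r z.1 * s z.1 z.2).toReal) 0)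
      (P₁ ⊗ₘ κP) := by
    refine Integrable.of_bound (C := 1) ?_ ?_
    · exact (((hgm.ennreal_toReal.const_mul γ).const_sub 1).max
        measurable_const).aestronglyMeasurable
    · refine Filter.Eventually.of_forall fun z => ?_
      have : 0 ≤ γ * (r z.1 * s z.1 z.2).toReal := mul_nonneg hγ ENNReal.toReal_nonneg
      rw [Real.norm_of_nonneg (le_max_right _ _)]
      exact max_le (by linarith) zero_le_one
  simp_rw [hpt]
  refine ⟨MeasureTheory.Integrable.integral_compProd (κ := Kernel.const Unit P₁)
    (η := Kernel.prodMkLeft Unit κP) (a := ()) hint, ?_⟩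
  rw [hs_eq _ _ _ _ hgm hd, Measure.integral_compProd hint]

/-- **Calibration points break the natural `f`-DP filter.** Let `P₁, Q₁` be mutually
absolutely continuous probability measures with `r = dQ₁/dP₁`, and let `(P₂a, Q₂a)` and
`(P₂b, Q₂b)` be two pairs of mutually absolutely continuous probability measures with
hockey-stick curves `h_a(γ) = D_γ(P₂a‖Q₂a)` and `h_b(γ) = D_γ(P₂b‖Q₂b)`.  Fix `γ₀ ≥ 0`
and let `A = {y₁ : h_a(γ₀·r(y₁)) ≥ h_b(γ₀·r(y₁))}` (assumed measurable; the
hockey-stick curves are convex and nonincreasing, hence Borel).  Define the adaptive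
kernels `κP, κQ` selecting the pair `a` on `A` and the pair `b` off `A`.  If both
`{h_a(γ₀·r) > h_b(γ₀·r)}` and `{h_a(γ₀·r) < h_b(γ₀·r)}` have positive `P₁`-measure,
then the adaptive composition strictly exceeds both tensor-product bounds:
`D_{γ₀}(P₁ ⊗ κP ‖ Q₁ ⊗ κQ) > max(D_{γ₀}(P₁×P₂a ‖ Q₁×Q₂a), D_{γ₀}(P₁×P₂b ‖ Q₁×Q₂b))`. -/
theorem adaptive_selection_exceeds_tensor_bounds
    {Ω₁ Ω₂ : Type*} [MeasurableSpace Ω₁] [MeasurableSpace Ω₂]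
    (P₁ Q₁ : Measure Ω₁) [IsProbabilityMeasure P₁] [IsProbabilityMeasure Q₁]
    (hPQ : P₁ ≪ Q₁) (hQP : Q₁ ≪ P₁)
    (P₂a Q₂a P₂b Q₂b : Measure Ω₂)
    [IsProbabilityMeasure P₂a] [IsProbabilityMeasure Q₂a]
    [IsProbabilityMeasure P₂b] [IsProbabilityMeasure Q₂b]
    (haca : P₂a ≪ Q₂a) (haca' : Q₂a ≪ P₂a)
    (hacb : P₂b ≪ Q₂b) (hacb' : Q₂b ≪ P₂b)
    (γ₀ : ℝ) (hγ₀ : 0 ≤ γ₀)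
    (hA : MeasurableSet {y₁ : Ω₁ |
        hockeyStick (γ₀ * (Q₁.rnDeriv P₁ y₁).toReal) P₂b Q₂b
          ≤ hockeyStick (γ₀ * (Q₁.rnDeriv P₁ y₁).toReal) P₂a Q₂a})
    (hposa : 0 < P₁ {y₁ : Ω₁ |
        hockeyStick (γ₀ * (Q₁.rnDeriv P₁ y₁).toReal) P₂b Q₂b
          < hockeyStick (γ₀ * (Q₁.rnDeriv P₁ y₁).toReal) P₂a Q₂a})
    (hposb : 0 < P₁ {y₁ : Ω₁ |
        hockeyStick (γ₀ * (Q₁.rnDeriv P₁ y₁).toReal) P₂a Q₂a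
          < hockeyStick (γ₀ * (Q₁.rnDeriv P₁ y₁).toReal) P₂b Q₂b}) :
    max (hockeyStick γ₀ (P₁.prod P₂a) (Q₁.prod Q₂a))
        (hockeyStick γ₀ (P₁.prod P₂b) (Q₁.prod Q₂b))
      < hockeyStick γ₀
          (P₁ ⊗ₘ (@Kernel.piecewise Ω₁ Ω₂ _ _ _ (Classical.decPred _) hA
            (Kernel.const Ω₁ P₂a) (Kernel.const Ω₁ P₂b)))
          (Q₁ ⊗ₘ (@Kernel.piecewise Ω₁ Ω₂ _ _ _ (Classical.decPred _) hA
            (Kernel.const Ω₁ Q₂a) (Kernel.const Ω₁ Q₂b))) := by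
  classical
  set A : Set Ω₁ := {y₁ : Ω₁ |
        hockeyStick (γ₀ * (Q₁.rnDeriv P₁ y₁).toReal) P₂b Q₂b
          ≤ hockeyStick (γ₀ * (Q₁.rnDeriv P₁ y₁).toReal) P₂a Q₂a} with hAdef
  have hda : Q₂a = P₂a.withDensity (Q₂a.rnDeriv P₂a) :=
    (Measure.withDensity_rnDeriv_eq _ _ haca').symm
  have hdb : Q₂b = P₂b.withDensity (Q₂b.rnDeriv P₂b) :=
    (Measure.withDensity_rnDeriv_eq _ _ hacb').symm
  have hma := Measure.measurable_rnDeriv Q₂a P₂a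
  have hmb := Measure.measurable_rnDeriv Q₂b P₂b
  obtain ⟨ia, ea⟩ := hs_comp P₁ Q₁ hQP (Kernel.const Ω₁ P₂a) (Kernel.const Ω₁ Q₂a)
    (fun _ => Q₂a.rnDeriv P₂a) (hma.comp measurable_snd) (fun x => by simpa using hda) γ₀ hγ₀
  obtain ⟨ib, eb⟩ := hs_comp P₁ Q₁ hQP (Kernel.const Ω₁ P₂b) (Kernel.const Ω₁ Q₂b)
    (fun _ => Q₂b.rnDeriv P₂b) (hmb.comp measurable_snd) (fun x => by simpa using hdb) γ₀ hγ₀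
  have hsm : Measurable (Function.uncurry (fun (x : Ω₁) (y : Ω₂) =>
      if x ∈ A then Q₂a.rnDeriv P₂a y else Q₂b.rnDeriv P₂b y)) :=
    Measurable.ite (measurable_fst hA) (hma.comp measurable_snd) (hmb.comp measurable_snd)
  obtain ⟨ic, ec⟩ := hs_comp P₁ Q₁ hQP
    (@Kernel.piecewise Ω₁ Ω₂ _ _ _ (Classical.decPred _) hA
            (Kernel.const Ω₁ P₂a) (Kernel.const Ω₁ P₂b))
    (@Kernel.piecewise Ω₁ Ω₂ _ _ _ (Classical.decPred _) hA
            (Kernel.const Ω₁ Q₂a) (Kernel.const Ω₁ Q₂b)) _ hsm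
    (fun x => by
      rw [Kernel.piecewise_apply, Kernel.piecewise_apply]
      by_cases hx : x ∈ A
      · simpa [hx] using hda
      · simpa [hx] using hdb) γ₀ hγ₀
  rw [Measure.compProd_const, Measure.compProd_const] at ea eb
  simp only [Kernel.const_apply] at ia ib ea eb
  have key : ∀ x, hockeyStick (γ₀ * (Q₁.rnDeriv P₁ x).toReal)
      ((@Kernel.piecewise Ω₁ Ω₂ _ _ _ (Classical.decPred _) hA
            (Kernel.const Ω₁ P₂a) (Kernel.const Ω₁ P₂b)) x)
      ((@Kernel.piecewise Ω₁ Ω₂ _ _ _ (Classical.decPred _) hA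
            (Kernel.const Ω₁ Q₂a) (Kernel.const Ω₁ Q₂b)) x) =
      max (hockeyStick (γ₀ * (Q₁.rnDeriv P₁ x).toReal) P₂a Q₂a)
        (hockeyStick (γ₀ * (Q₁.rnDeriv P₁ x).toReal) P₂b Q₂b) := by
    intro x
    rw [Kernel.piecewise_apply, Kernel.piecewise_apply]
    by_cases hx : x ∈ A
    · simp only [hx, if_true, Kernel.const_apply]
      exact (max_eq_left hx).symm
    · simp only [hx, if_false, Kernel.const_apply]
      exact (max_eq_right (le_of_not_ge hx)).symm
  simp_rw [key] at ic ec
  rw [ec, ea, eb]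
  refine max_lt ?_ ?_
  · refine int_lt ia ic
      (fun x => le_max_left _ _) ?_
    simpa using hposb.ne'
  · refine int_lt ib ic
      (fun x => le_max_right _ _) ?_
    simpa using hposa.ne'
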